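/- Let K be a field, n ≥ 3, and let S_n be the monoid presented by generators a_1, …, a_n and relations a_1 a_2 ⋯ a_n = a_{σ(1)} ⋯ a_{σ(n)} for σ in the cyclic group generated by the n-cycle. Then the monoid algebra K[S_n] is semiprimitive, i.e. its Jacobson radical is zero. -/

import Mathlib

/-- The word `a_{σ(1)} a_{σ(2)} ⋯ a_{σ(n)}` in the free monoid on `n` generators. -/
def permWord (n : ℕ) (σ : Equiv.Perm (Fin n)) : FreeMonoid (Fin n) :=
  ((List.finRange n).map fun i => FreeMonoid.of (σ i)).prod

/-- The defining relations `a_1 a_2 ⋯ a_n = a_{σ(1)} a_{σ(2)} ⋯ a_{σ(n)}`, where `σ` runs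
through the cyclic subgroup of `Sym_n` generated by the `n`-cycle `(1,2,…,n)` (i.e. `finRotate n`). -/
def cycRel (n : ℕ) : FreeMonoid (Fin n) → FreeMonoid (Fin n) → Prop :=
  fun x y => x = permWord n 1 ∧ ∃ k : ℕ, y = permWord n (finRotate n ^ k)

/-- The monoid `S_n` presented by generators `a_1, …, a_n` and the above relations. -/
def Scyc (n : ℕ) : Type := (conGen (cycRel n)).Quotient

instance (n : ℕ) : Monoid (Scyc n) := Con.monoid _

/-- The generator `a_i` of `S_n`. -/
def agen {n : ℕ} (i : Fin n) : Scyc n := (conGen (cycRel n)).mk' (FreeMonoid.of i)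

/-- The element `z = a_1 a_2 ⋯ a_n` of `S_n`. -/
def zc (n : ℕ) : Scyc n := ((List.finRange n).map agen).prod

/-- A criterion for semiprimitivity of the algebra of a cancellative monoid graded by `deg`:
every finite set can be moved by two-sided multiplication into a subsemigroup `T` that, together
with `1`, has unique products of large size. -/
theorem MonoidAlgebra.jacobson_bot_eq_bot_of_subsemigroup {K M : Type*} [Field K]
    [Monoid M] [IsCancelMul M] (deg : M →* Multiplicative ℕ) (hdeg : ∀ s, deg s = 1 → s = 1)
    (T : Subsemigroup M) (h_one : 1 ∉ T)
    (hT : ∀ A : Finset M, ∃ p q : M, ∀ s ∈ A, p * s * q ∈ T)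
    (huniq : ∀ A B : Finset M, A.Nonempty → B.Nonempty → (∀ s ∈ A, s = 1 ∨ s ∈ T) →
      (∀ t ∈ B, t ∈ T) → ∃ a ∈ A, ∃ b ∈ B, UniqueMul A B a b ∧ a * b ∉ A ∧ a * b ≠ 1) :
    Ideal.jacobson (⊥ : Ideal (MonoidAlgebra K M)) = ⊥ := by
  classical
  rw [eq_bot_iff]
  intro x hx
  by_contra hx0
  obtain ⟨p, q, hpq⟩ := hT x.coeff.support
  set y : MonoidAlgebra K M := single p 1 * x * single q 1 with hy
  have hyJ : y ∈ Ideal.jacobson (⊥ : Ideal (MonoidAlgebra K M)) :=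
    Ideal.mul_mem_right _ _ (Ideal.mul_mem_left _ _ hx)
  have hyT : ∀ t ∈ y.coeff.support, t ∈ T := by
    intro t ht
    obtain ⟨s, hs, rfl⟩ := Finset.mem_image.1 (support_coeff_mul_single_subset _ _ _ ht)
    obtain ⟨r, hr, rfl⟩ := Finset.mem_image.1 (support_coeff_single_mul_subset _ _ _ hs)
    exact hpq r hr
  have hy0 : y.coeff.support.Nonempty := by
    have hx1 : x.coeff ≠ 0 := fun h => hx0 (by rw [Ideal.mem_bot, ← coeff_eq_zero]; exact h)
    obtain ⟨r, hr⟩ := Finsupp.support_nonempty_iff.2 hx1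
    refine ⟨p * r * q, ?_⟩
    rw [Finsupp.mem_support_iff] at hr ⊢
    have h1 : UniqueMul (single p (1 : K)).coeff.support x.coeff.support p r := by
      intro a b ha _ hab
      have : a = p := by simpa using Finsupp.support_single_subset ha
      subst this
      exact ⟨rfl, mul_left_cancel hab⟩
    have h2 : UniqueMul (single p (1 : K) * x).coeff.support (single q (1 : K)).coeff.support
        (p * r) q := by
      intro a b _ hb hab
      have : b = q := by simpa using Finsupp.support_single_subset hb
      subst this
      exact ⟨mul_right_cancel hab, rfl⟩
    rw [hy, coeff_mul_mul_of_uniqueMul h2, coeff_mul_mul_of_uniqueMul h1]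
    simpa [coeff_single] using hr
  obtain ⟨u, hu⟩ := Ideal.mem_jacobson_iff.1 hyJ 1
  rw [mul_one, Ideal.mem_bot, sub_eq_zero] at hu
  have hcoeff : ∀ s, (u * y).coeff s + u.coeff s = (1 : MonoidAlgebra K M).coeff s := by
    intro s
    rw [← hu]
    rfl
  have h1 : ∀ s : M, s ≠ 1 → (1 : MonoidAlgebra K M).coeff s = 0 := by
    intro s hs
    rw [one_def, coeff_single, Finsupp.single_eq_of_ne hs]
  have huT : ∀ d : ℕ, ∀ s ∈ u.coeff.support, (deg s).toAdd = d → s = 1 ∨ s ∈ T := by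
    intro d
    induction d using Nat.strong_induction_on with
    | _ d ih =>
      intro s hs hsd
      by_cases hs1 : s = 1
      · exact Or.inl hs1
      right
      have h2 := hcoeff s
      rw [h1 s hs1] at h2
      have h3 : s ∈ (u * y).coeff.support := by
        rw [Finsupp.mem_support_iff] at hs ⊢
        intro h
        rw [h, zero_add] at h2
        exact hs h2
      obtain ⟨a, ha, b, hb, rfl⟩ := Finset.mem_mul.1 (support_coeff_mul_subset _ _ h3)
      have hbT := hyT b hb
      have hb1 : (deg b).toAdd ≠ 0 := fun h => h_one (hdeg b h ▸ hbT)
      rw [map_mul, toAdd_mul] at hsd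
      rcases ih _ (by omega) a ha rfl with rfl | haT
      · rwa [one_mul]
      · exact T.mul_mem haT hbT
  have hu0 : u.coeff.support.Nonempty := by
    rw [Finsupp.support_nonempty_iff]
    intro h
    have : u = 0 := by rw [← coeff_eq_zero]; exact h
    rw [this, zero_mul, zero_add] at hu
    exact zero_ne_one hu
  obtain ⟨a, ha, b, hb, hab, habA, hab1⟩ :=
    huniq _ _ hu0 hy0 (fun s hs => huT _ s hs rfl) hyT
  have h2 := hcoeff (a * b)
  rw [h1 _ hab1, Finsupp.notMem_support_iff.1 habA, add_zero,
    coeff_mul_mul_of_uniqueMul hab] at h2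
  exact mul_ne_zero (Finsupp.mem_support_iff.1 ha) (Finsupp.mem_support_iff.1 hb) h2

namespace Scyc

open Filter

variable {n : ℕ}

theorem val_finRotate_pow (k : ℕ) (i : Fin n) : ((finRotate n ^ k) i : ℕ) = (i + k) % n := by
  have hn : 0 < n := i.pos
  induction k with
  | zero => simp [Nat.mod_eq_of_lt i.isLt]
  | succ k ih =>
    obtain ⟨m, rfl⟩ : ∃ m, n = m + 1 := ⟨n - 1, by omega⟩
    rw [pow_succ', Equiv.Perm.mul_apply, finRotate_apply, Fin.val_add, ih]
    simp [add_assoc]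

theorem finRotate_pow_self (n : ℕ) : finRotate n ^ n = 1 := by
  ext i
  simp [val_finRotate_pow, Nat.mod_eq_of_lt i.isLt]

theorem finRotate_pow_apply_ne (i : Fin n) {k : ℕ} (hk : 0 < k) (hkn : k < n) :
    (finRotate n ^ k) i ≠ i := by
  intro h
  have h1 := congrArg Fin.val h
  rw [val_finRotate_pow] at h1
  have hi := i.isLt
  rcases lt_or_ge (i.val + k) n with h2 | h2
  · rw [Nat.mod_eq_of_lt h2] at h1
    omega
  · rw [Nat.mod_eq_sub_mod h2, Nat.mod_eq_of_lt (by omega)] at h1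
    omega

/-- The list `[i, i + 1, …, i + r - 1]` of cyclically consecutive letters. -/
def run (i : Fin n) : ℕ → List (Fin n)
  | 0 => []
  | r + 1 => i :: run (finRotate n i) r

@[simp]
theorem length_run (i : Fin n) (r : ℕ) : (run i r).length = r := by
  induction r generalizing i with
  | zero => rfl
  | succ r ih => simp [run, ih]

theorem run_add (i : Fin n) (a b : ℕ) :
    run i (a + b) = run i a ++ run ((finRotate n ^ a) i) b := by
  induction a generalizing i with
  | zero => simp [run]
  | succ a ih => rw [Nat.succ_add, run, run, ih, pow_succ, Equiv.Perm.mul_apply, List.cons_append]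

theorem getLast?_run_succ (i : Fin n) (r : ℕ) :
    (run i (r + 1)).getLast? = some ((finRotate n ^ r) i) := by
  rw [run_add]
  simp [run]

theorem getElem_run (i : Fin n) (r k : ℕ) (hk : k < (run i r).length) :
    (run i r)[k] = (finRotate n ^ k) i := by
  induction r generalizing i k with
  | zero => simp [run] at hk
  | succ r ih =>
    cases k with
    | zero => simp [run]
    | succ k => simp only [run, List.getElem_cons_succ, ih, pow_succ, Equiv.Perm.mul_apply]

/-- The letters that complete `i` to a cyclic rotation of the word `a_1 a_2 ⋯ a_n`. -/
def rest (i : Fin n) : List (Fin n) := run (finRotate n i) (n - 1)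

@[simp]
theorem length_rest (i : Fin n) : (rest i).length = n - 1 := length_run _ _

theorem cons_rest (i : Fin n) : i :: rest i = run i n := by
  obtain ⟨m, rfl⟩ : ∃ m, n = m + 1 := ⟨n - 1, by have := i.pos; omega⟩
  rfl

theorem rest_eq_cons (hn : 2 ≤ n) (i : Fin n) : ∃ l, rest i = finRotate n i :: l := by
  obtain ⟨m, rfl⟩ : ∃ m, n = m + 2 := ⟨n - 2, by omega⟩
  exact ⟨_, rfl⟩

theorem head?_of_rest_prefix (hn : 2 ≤ n) {i : Fin n} {w : List (Fin n)} (h : rest i <+: w) :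
    w.head? = some (finRotate n i) := by
  obtain ⟨l, hl⟩ := rest_eq_cons hn i
  obtain ⟨t, rfl⟩ := h
  simp [hl]

/-- A word is reduced if no cyclic rotation of `a_1 a_2 ⋯ a_n` is a factor of it. -/
def IsReduced : List (Fin n) → Prop
  | [] => True
  | i :: w => ¬ rest i <+: w ∧ IsReduced w

theorem IsReduced.of_append_right {u v : List (Fin n)} (h : IsReduced (u ++ v)) :
    IsReduced v := by
  induction u with
  | nil => exact h
  | cons i u ih => exact ih h.2

theorem IsReduced.drop {w : List (Fin n)} (h : IsReduced w) (k : ℕ) : IsReduced (w.drop k) :=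
  IsReduced.of_append_right (u := w.take k) (by rwa [List.take_append_drop])

theorem IsReduced.run_append {w : List (Fin n)} (hw : IsReduced w) (i : Fin n) {r : ℕ}
    (hr : r < n) (h : w.head? ≠ some ((finRotate n ^ r) i)) : IsReduced (run i r ++ w) := by
  induction r generalizing i with
  | zero => exact hw
  | succ r ih =>
    rw [pow_succ, Equiv.Perm.mul_apply] at h
    refine ⟨fun hp => h ?_, ih _ (by omega) h⟩
    obtain ⟨s, hs⟩ : ∃ s, n - 1 = r + (s + 1) := ⟨n - 1 - r - 1, by omega⟩
    rw [rest, hs, run_add] at hp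
    replace hp := (List.prefix_append_right_inj _).1 hp
    obtain ⟨t, rfl⟩ := hp
    rfl

theorem isReduced_append (hn : 2 ≤ n) {u v : List (Fin n)} (hu : IsReduced u) (hv : IsReduced v)
    (h : ∀ a ∈ u.getLast?, ∀ b ∈ v.head?, b ≠ finRotate n a) : IsReduced (u ++ v) := by
  induction u with
  | nil => exact hv
  | cons i u ih =>
    refine ⟨fun hp => ?_, ih hu.2 fun a ha => h a ?_⟩
    · rcases List.eq_nil_or_concat' u with rfl | ⟨u', a, rfl⟩
      · exact h i (by simp) _ (head?_of_rest_prefix hn hp) rfl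
      · rcases le_or_gt (rest i).length (u' ++ [a]).length with hl | hl
        · exact hu.1 (List.prefix_of_prefix_length_le hp (List.prefix_append _ _) hl)
        · have hk1 : u'.length < (rest i).length := by simp at hl ⊢; omega
          have hk2 : u'.length + 1 < (rest i).length := by simp at hl ⊢; omega
          have e1 := hp.getElem hk1
          have e2 := hp.getElem hk2
          have hv0 : v ≠ [] := by
            rintro rfl
            have := hp.length_le
            simp at this hk2
            omega
          obtain ⟨b, v', rfl⟩ := List.exists_cons_of_ne_nil hv0
          simp only [rest, getElem_run] at e1 e2
          simp [-finRotate_apply, pow_succ' _ (u'.length)] at e1 e2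
          refine h a (by simp [List.getLast?_cons]) b rfl ?_
          rw [← e2, ← e1]
    · cases u with
      | nil => simp at ha
      | cons c u => simpa using ha

theorem exists_eq_run_append (w : List (Fin n)) (i : Fin n) (r : ℕ) :
    ∃ l ≤ r, ∃ w', w = run i l ++ w' ∧ (l < r → w'.head? ≠ some ((finRotate n ^ l) i)) := by
  induction r generalizing w i with
  | zero => exact ⟨0, le_rfl, w, rfl, by simp⟩
  | succ r ih =>
    by_cases h : w.head? = some i
    · obtain ⟨t, rfl⟩ := List.head?_eq_some_iff.1 h
      obtain ⟨l, hl, w', rfl, hw'⟩ := ih t (finRotate n i)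
      refine ⟨l + 1, by omega, w', rfl, fun hlr => ?_⟩
      rw [pow_succ, Equiv.Perm.mul_apply]
      exact hw' (by omega)
    · exact ⟨0, by omega, w, rfl, fun _ => h⟩

open Classical in
/-- Left multiplication by the generator `a_i` on pairs `(m, w)`, which stand for `z ^ m * w`. -/
noncomputable def act (i : Fin n) (x : ℕ × List (Fin n)) : ℕ × List (Fin n) :=
  if rest i <+: x.2 then (x.1 + 1, x.2.drop (n - 1)) else (x.1, i :: x.2)

theorem act_rest_append (i : Fin n) (m : ℕ) (w : List (Fin n)) :
    act i (m, rest i ++ w) = (m + 1, w) := by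
  simp [act, List.drop_left' (length_rest i)]

theorem act_of_not_prefix {i : Fin n} {x : ℕ × List (Fin n)} (h : ¬ rest i <+: x.2) :
    act i x = (x.1, i :: x.2) := if_neg h

theorem isReduced_act (i : Fin n) {x : ℕ × List (Fin n)} (hx : IsReduced x.2) :
    IsReduced (act i x).2 := by
  unfold act
  split_ifs with h
  · exact hx.drop _
  · exact ⟨h, hx⟩

theorem foldr_act_of_isReduced {u w : List (Fin n)} (h : IsReduced (u ++ w)) (m : ℕ) :
    u.foldr act (m, w) = (m, u ++ w) := by
  induction u with
  | nil => rfl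
  | cons i u ih => rw [List.foldr_cons, ih h.2, act_of_not_prefix h.1, List.cons_append]

theorem foldr_act_run {w : List (Fin n)} (hw : IsReduced w) (i : Fin n) (m : ℕ) :
    (run i n).foldr act (m, w) = (m + 1, w) := by
  obtain ⟨l, hl, w', rfl, hw'⟩ := exists_eq_run_append w i n
  have hln : l ≠ n := by
    rintro rfl
    rw [← cons_rest] at hw
    exact hw.1 (List.prefix_append _ _)
  replace hw' := hw' (by omega)
  obtain ⟨s, hs⟩ : ∃ s, n = l + (1 + s) := ⟨n - l - 1, by omega⟩
  have e : run i n = run i l ++ ((finRotate n ^ l) i :: run ((finRotate n ^ (l + 1)) i) s) := by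
    rw [congrArg (run i) hs, run_add, run_add, pow_one, ← Equiv.Perm.mul_apply, ← pow_succ']
    rfl
  have e' : rest ((finRotate n ^ l) i) = run ((finRotate n ^ (l + 1)) i) s ++ run i l := by
    rw [rest, show n - 1 = s + l by omega, run_add, ← Equiv.Perm.mul_apply, ← pow_succ',
      ← Equiv.Perm.mul_apply, ← pow_add, show s + (l + 1) = n by omega, finRotate_pow_self]
    rfl
  have hred : IsReduced (run ((finRotate n ^ (l + 1)) i) s ++ (run i l ++ w')) := by
    rw [← List.append_assoc, ← e', rest]
    refine hw.of_append_right.run_append _ (by omega) ?_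
    rwa [← Equiv.Perm.mul_apply, ← pow_succ, show n - 1 + 1 = n by omega, finRotate_pow_self]
  rw [e, List.foldr_append, List.foldr_cons, foldr_act_of_isReduced hred, ← List.append_assoc, ← e',
    act_rest_append, foldr_act_of_isReduced hw]

/-- The pairs `(m, w)` with `w` reduced: the normal forms `z ^ m * w` of the elements of `S_n`. -/
abbrev NormalForm (n : ℕ) : Type := {x : ℕ × List (Fin n) // IsReduced x.2}

/-- The action of the free monoid on normal forms by left multiplication. -/
noncomputable def freeAction (n : ℕ) : FreeMonoid (Fin n) →* Function.End (NormalForm n) :=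
  FreeMonoid.lift fun i x => ⟨act i x.1, isReduced_act i x.2⟩

theorem freeAction_apply (u : List (Fin n)) (x : NormalForm n) :
    (freeAction n (FreeMonoid.ofList u) x).1 = u.foldr act x.1 := by
  induction u with
  | nil => rfl
  | cons i u ih =>
    rw [FreeMonoid.ofList_cons, map_mul, List.foldr_cons, ← ih]
    rfl

theorem permWord_eq_ofList (σ : Equiv.Perm (Fin n)) :
    permWord n σ = FreeMonoid.ofList ((List.finRange n).map σ) := by
  rw [permWord]
  induction List.finRange n with
  | nil => rfl
  | cons i l ih => rw [List.map_cons, List.prod_cons, ih]; rfl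

theorem finRange_map_finRotate_pow [NeZero n] (k : ℕ) :
    (List.finRange n).map (finRotate n ^ k) = run ((finRotate n ^ k) 0) n := by
  refine List.ext_getElem (by simp) fun j h1 h2 => ?_
  rw [getElem_run, List.getElem_map, ← Equiv.Perm.mul_apply, ← pow_add, Fin.ext_iff,
    val_finRotate_pow, val_finRotate_pow]
  simp

theorem exists_permWord_eq [NeZero n] (k : ℕ) :
    ∃ i, permWord n (finRotate n ^ k) = FreeMonoid.ofList (run i n) :=
  ⟨_, by rw [permWord_eq_ofList, finRange_map_finRotate_pow]⟩

theorem freeAction_run (i : Fin n) (x : NormalForm n) :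
    freeAction n (FreeMonoid.ofList (run i n)) x = ⟨(x.1.1 + 1, x.1.2), x.2⟩ :=
  Subtype.ext (by rw [freeAction_apply]; exact foldr_act_run x.2 i _)

/-- The action of `S_n` on normal forms by left multiplication. -/
noncomputable def action (n : ℕ) [NeZero n] : Scyc n →* Function.End (NormalForm n) :=
  (conGen (cycRel n)).lift (freeAction n) <| Con.conGen_le.2 <| by
    rintro x y ⟨rfl, k, rfl⟩
    obtain ⟨i, hi⟩ := exists_permWord_eq (n := n) 0
    obtain ⟨j, hj⟩ := exists_permWord_eq (n := n) k
    rw [pow_zero] at hi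
    rw [Con.ker_rel, hi, hj]
    funext x
    rw [freeAction_run, freeAction_run]

/-- The element of `S_n` represented by a word. -/
def word (u : List (Fin n)) : Scyc n := (conGen (cycRel n)).mk' (FreeMonoid.ofList u)

theorem word_append (u v : List (Fin n)) : word (u ++ v) = word u * word v := rfl

theorem word_cons (i : Fin n) (u : List (Fin n)) : word (i :: u) = agen i * word u := rfl

theorem word_surjective : Function.Surjective (word (n := n)) := fun s => by
  obtain ⟨u, rfl⟩ := Con.mk'_surjective s
  exact ⟨u.toList, rfl⟩

theorem action_word [NeZero n] (u : List (Fin n)) (x : NormalForm n) :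
    (action n (word u) x).1 = u.foldr act x.1 := freeAction_apply u x

theorem word_finRange : word (List.finRange n) = zc n := by
  rw [zc]
  induction List.finRange n with
  | nil => rfl
  | cons i l ih => rw [word_cons, ih, List.map_cons, List.prod_cons]

theorem word_run [NeZero n] (i : Fin n) : word (run i n) = zc n := by
  have hi : i = (finRotate n ^ (i : ℕ)) 0 := by
    rw [Fin.ext_iff, val_finRotate_pow]
    simp [Nat.mod_eq_of_lt i.isLt]
  rw [hi, ← finRange_map_finRotate_pow, word, ← permWord_eq_ofList, ← word_finRange]
  refine ((Con.eq _).2 (ConGen.Rel.of _ _ ⟨?_, _, rfl⟩)).symm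
  rw [permWord_eq_ofList]
  exact congrArg FreeMonoid.ofList (List.map_id _).symm

theorem agen_mul_zc [NeZero n] (i : Fin n) : agen i * zc n = zc n * agen i := by
  have h : i :: run (finRotate n i) n = run i n ++ [i] := by
    have h1 : i :: run (finRotate n i) n = run i (n + 1) := rfl
    rw [h1, run_add, finRotate_pow_self]
    rfl
  rw [← word_run (finRotate n i), ← word_cons, h, word_append, word_run, word_run]
  rfl

theorem commute_zc [NeZero n] (s : Scyc n) : Commute s (zc n) := by
  obtain ⟨u, rfl⟩ := word_surjective s
  induction u with
  | nil => exact Commute.one_left _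
  | cons i u ih =>
    rw [word_cons]
    exact Commute.mul_left (agen_mul_zc i) ih

/-- The element of `S_n` with a given normal form. -/
def ofPair (x : ℕ × List (Fin n)) : Scyc n := zc n ^ x.1 * word x.2

theorem ofPair_act [NeZero n] (i : Fin n) (x : ℕ × List (Fin n)) :
    ofPair (act i x) = agen i * ofPair x := by
  obtain ⟨m, w⟩ := x
  by_cases h : rest i <+: w
  · obtain ⟨t, rfl⟩ := h
    have h1 : agen i * word (rest i) = zc n := by rw [← word_cons, cons_rest, word_run]
    rw [act_rest_append, ofPair, ofPair, word_append, ← mul_assoc, ← mul_assoc]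
    simp only [((commute_zc (agen i)).pow_right m).eq]
    rw [mul_assoc _ (agen i), h1, pow_succ]
  · rw [act_of_not_prefix h, ofPair, ofPair, word_cons, ← mul_assoc, ← mul_assoc]
    simp only [((commute_zc (agen i)).pow_right m).eq]

theorem ofPair_foldr_act [NeZero n] (u : List (Fin n)) (x : ℕ × List (Fin n)) :
    ofPair (u.foldr act x) = word u * ofPair x := by
  induction u with
  | nil => exact (one_mul _).symm
  | cons i u ih => rw [List.foldr_cons, ofPair_act, ih, word_cons, mul_assoc]

/-- The normal form of an element of `S_n`. -/
noncomputable def normalForm [NeZero n] (s : Scyc n) : NormalForm n := action n s ⟨(0, []), trivial⟩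

theorem ofPair_normalForm [NeZero n] (s : Scyc n) : ofPair (normalForm s).1 = s := by
  obtain ⟨u, rfl⟩ := word_surjective s
  rw [normalForm, action_word, ofPair_foldr_act, ofPair, pow_zero, one_mul]
  exact mul_one _

theorem normalForm_injective [NeZero n] : Function.Injective (normalForm (n := n)) :=
  fun s t h => by rw [← ofPair_normalForm s, h, ofPair_normalForm]

theorem normalForm_mul [NeZero n] (s t : Scyc n) :
    normalForm (s * t) = action n s (normalForm t) := by
  rw [normalForm, map_mul]
  rfl

theorem normalForm_agen_mul [NeZero n] (i : Fin n) (s : Scyc n) :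
    (normalForm (agen i * s)).1 = act i (normalForm s).1 := by
  rw [normalForm_mul]
  exact action_word [i] _

theorem action_zc_pow [NeZero n] (k : ℕ) (x : NormalForm n) :
    action n (zc n ^ k) x = ⟨(k + x.1.1, x.1.2), x.2⟩ := by
  induction k with
  | zero => simp; rfl
  | succ k ih =>
    rw [pow_succ', map_mul]
    change action n (zc n) (action n (zc n ^ k) x) = _
    rw [ih, ← word_run 0]
    refine Subtype.ext ((action_word _ _).trans ?_)
    rw [foldr_act_run x.2]
    simp [add_right_comm]

theorem normalForm_mul_of_isReduced [NeZero n] (s t : Scyc n)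
    (h : IsReduced ((normalForm s).1.2 ++ (normalForm t).1.2)) :
    (normalForm (s * t)).1 = ((normalForm s).1.1 + (normalForm t).1.1,
      (normalForm s).1.2 ++ (normalForm t).1.2) := by
  conv_lhs => rw [← ofPair_normalForm s]
  have h1 : (action n (word (normalForm s).1.2) (normalForm t)).1 =
      ((normalForm t).1.1, (normalForm s).1.2 ++ (normalForm t).1.2) := by
    rw [action_word, ← foldr_act_of_isReduced h]
  rw [ofPair, mul_assoc, normalForm_mul, action_zc_pow, normalForm_mul]
  simp only [h1]

theorem zc_mul_injective [NeZero n] : Function.Injective fun s : Scyc n => zc n * s := by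
  intro s t h
  have h1 := congrArg (fun s => (normalForm s).1) h
  simp only at h1
  rw [normalForm_mul, normalForm_mul, ← pow_one (zc n), action_zc_pow, action_zc_pow] at h1
  refine normalForm_injective (Subtype.ext (Prod.ext ?_ ?_))
  · simpa using congrArg Prod.fst h1
  · exact (congrArg Prod.snd h1 :)

theorem exists_mul_eq_zc_pow [NeZero n] (s : Scyc n) : ∃ t k, t * s = zc n ^ k := by
  obtain ⟨u, rfl⟩ := word_surjective s
  induction u with
  | nil => exact ⟨1, 0, by rw [one_mul, pow_zero]; rfl⟩
  | cons i u ih =>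
    obtain ⟨t, k, h⟩ := ih
    refine ⟨t * word (rest i), k + 1, ?_⟩
    have h1 : word (rest i) * agen i = zc n := by
      change word (rest i ++ [i]) = zc n
      rw [← word_run (finRotate n i)]
      congr 1
      have hn : n = n - 1 + 1 := by have := i.pos; omega
      rw [congrArg (run (finRotate n i)) hn, run_add, ← Equiv.Perm.mul_apply, ← pow_succ, ← hn,
        finRotate_pow_self]
      rfl
    rw [word_cons, mul_assoc, ← mul_assoc (word (rest i)), h1, (commute_zc _).symm.eq, ← mul_assoc,
      h, pow_succ]

theorem zc_pow_mul_injective [NeZero n] (k : ℕ) :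
    Function.Injective fun s : Scyc n => zc n ^ k * s := by
  induction k with
  | zero => exact fun s t h => by simpa using h
  | succ k ih =>
    intro s t h
    simp only [pow_succ', mul_assoc] at h
    exact ih (zc_mul_injective h)

theorem left_mul_injective [NeZero n] (s : Scyc n) : Function.Injective fun t => s * t := by
  intro t u h
  obtain ⟨r, k, hr⟩ := exists_mul_eq_zc_pow s
  refine zc_pow_mul_injective k ?_
  simp only at h
  simp only [← hr, mul_assoc, h]

instance [NeZero n] : IsCancelMul (Scyc n) where
  mul_left_cancel s _ _ h := left_mul_injective s h
  mul_right_cancel s t u h := by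
    obtain ⟨r, k, hr⟩ := exists_mul_eq_zc_pow s
    have hr' : s * r = zc n ^ k := by
      refine left_mul_injective r ?_
      simp only [← mul_assoc, hr]
      exact ((commute_zc r).pow_right k).eq.symm
    refine zc_pow_mul_injective k ?_
    have h1 : t * s * r = u * s * r := congrArg (· * r) h
    rw [mul_assoc, mul_assoc, hr', ((commute_zc t).pow_right k).eq,
      ((commute_zc u).pow_right k).eq] at h1
    exact h1

theorem normalForm_one [NeZero n] : (normalForm (1 : Scyc n)).1 = (0, []) := by
  rw [normalForm, map_one]
  rfl

/-- The degree homomorphism of `S_n`, given by the length of words. -/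
def deg (n : ℕ) [NeZero n] : Scyc n →* Multiplicative ℕ :=
  (conGen (cycRel n)).lift (FreeMonoid.lift fun _ => Multiplicative.ofAdd 1) <| Con.conGen_le.2 <| by
    rintro x y ⟨rfl, k, rfl⟩
    simp [Con.ker_rel, permWord, map_list_prod, Function.comp_def]

theorem deg_word [NeZero n] (u : List (Fin n)) : (deg n (word u)).toAdd = u.length := by
  induction u with
  | nil => rfl
  | cons i u ih =>
    rw [word_cons, map_mul, toAdd_mul, ih, List.length_cons, add_comm]
    rfl

theorem eq_one_of_deg_eq_one [NeZero n] (s : Scyc n) (h : deg n s = 1) : s = 1 := by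
  obtain ⟨u, rfl⟩ := word_surjective s
  have h1 := deg_word u
  rw [h, toAdd_one, eq_comm, List.length_eq_zero_iff] at h1
  rw [h1]
  rfl

theorem finRotate_apply_ne (hn : 2 ≤ n) (i : Fin n) : finRotate n i ≠ i := by
  simpa only [pow_one] using finRotate_pow_apply_ne i (k := 1) (by omega) (by omega)

theorem finRotate_finRotate_apply_ne (hn : 3 ≤ n) (i : Fin n) :
    finRotate n (finRotate n i) ≠ i := by
  simpa only [pow_two, Equiv.Perm.mul_apply] using
    finRotate_pow_apply_ne i (k := 2) (by omega) (by omega)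

theorem act_of_head?_eq (hn : 2 ≤ n) {i : Fin n} {x : ℕ × List (Fin n)}
    (h : x.2.head? = some i) : act i x = (x.1, i :: x.2) :=
  act_of_not_prefix fun hp => finRotate_apply_ne hn i <| by
    have h1 := head?_of_rest_prefix hn hp
    rw [h] at h1
    exact (Option.some_injective _ h1).symm

theorem normalForm_agen_pow [NeZero n] (hn : 2 ≤ n) (i : Fin n) (k : ℕ) :
    (normalForm (agen i ^ k)).1 = (0, List.replicate k i) := by
  induction k with
  | zero => exact normalForm_one
  | succ k ih =>
    rw [pow_succ', normalForm_agen_mul, ih, List.replicate_succ]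
    refine act_of_not_prefix fun hp => ?_
    have h1 := head?_of_rest_prefix hn hp
    rw [List.head?_replicate] at h1
    split_ifs at h1
    exact finRotate_apply_ne hn i (Option.some_injective _ h1).symm

theorem replicate_suffix_act {i j : Fin n} {k : ℕ} {x : ℕ × List (Fin n)}
    (h : List.replicate (k + n) j <:+ x.2) : List.replicate k j <:+ (act i x).2 := by
  have hk : List.replicate k j <:+ x.2 := by
    refine List.IsSuffix.trans ?_ h
    rw [add_comm, List.replicate_add]
    exact List.suffix_append _ _
  unfold act
  split_ifs
  · refine List.suffix_of_suffix_length_le hk (List.drop_suffix _ _) ?_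
    have := h.length_le
    simp at this ⊢
    omega
  · exact hk.trans (List.suffix_cons _ _)

theorem eventually_replicate_suffix [NeZero n] (hn : 2 ≤ n) (j : Fin n) (s : Scyc n) (k : ℕ) :
    ∀ᶠ l in atTop, List.replicate k j <:+ (normalForm (s * agen j ^ l)).1.2 := by
  obtain ⟨u, rfl⟩ := word_surjective s
  induction u generalizing k with
  | nil =>
    filter_upwards [eventually_ge_atTop k] with l hl
    have h1 : word [] * agen j ^ l = agen j ^ l := one_mul _
    obtain ⟨d, rfl⟩ := Nat.exists_eq_add_of_le' hl
    rw [h1, normalForm_agen_pow hn, List.replicate_add]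
    exact List.suffix_append _ _
  | cons i u ih =>
    filter_upwards [ih (k + n)] with l hl
    rw [word_cons, mul_assoc, normalForm_agen_mul]
    exact replicate_suffix_act hl

theorem getLast?_act_self (hn : 3 ≤ n) {i : Fin n} {x : ℕ × List (Fin n)}
    (h : x.2.getLast? = some (finRotate n i)) :
    (act i x).2.getLast? = some (finRotate n i) := by
  obtain ⟨m, w⟩ := x
  by_cases hp : rest i <+: w
  · obtain ⟨t, rfl⟩ := hp
    rw [act_rest_append]
    rcases List.eq_nil_or_concat' t with rfl | ⟨t', a, rfl⟩
    · exfalso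
      obtain ⟨r, hr⟩ : ∃ r, n - 1 = r + 1 := ⟨n - 2, by omega⟩
      rw [List.append_nil, rest, hr, getLast?_run_succ] at h
      exact finRotate_pow_apply_ne (finRotate n i) (k := r) (by omega) (by omega)
        (Option.some_injective _ h)
    · simpa [-finRotate_apply, ← List.append_assoc] using h
  · rw [act_of_not_prefix hp, List.getLast?_cons, h]
    rfl

theorem eventually_head?_act (hn : 3 ≤ n) {i : Fin n} {x : ℕ × List (Fin n)}
    (h : x.2.getLast? = some (finRotate n i)) :
    ∀ᶠ k in atTop, ((act i)^[k] x).2.head? = some i ∧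
      ((act i)^[k] x).2.getLast? = some (finRotate n i) := by
  have hlast (k : ℕ) : ((act i)^[k] x).2.getLast? = some (finRotate n i) := by
    induction k with
    | zero => exact h
    | succ k ih =>
      rw [Function.iterate_succ_apply']
      exact getLast?_act_self hn ih
  have hhead : ∃ k, ((act i)^[k] x).2.head? = some i := by
    by_contra! hne
    have hlen (k : ℕ) : ((act i)^[k] x).2.length + k ≤ x.2.length := by
      induction k with
      | zero => exact le_rfl
      | succ k ih =>
        have hk := hne (k + 1)
        rw [Function.iterate_succ_apply'] at hk ⊢
        by_cases hp : rest i <+: ((act i)^[k] x).2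
        · have := hp.length_le
          rw [length_rest] at this
          rw [act, if_pos hp, List.length_drop]
          omega
        · rw [act_of_not_prefix hp] at hk
          exact absurd rfl hk
    have := hlen (x.2.length + 1)
    omega
  obtain ⟨k, hk⟩ := hhead
  filter_upwards [eventually_ge_atTop k] with l hl
  refine ⟨?_, hlast l⟩
  induction l, hl using Nat.le_induction with
  | base => exact hk
  | succ l _ ih =>
    rw [Function.iterate_succ_apply', act_of_head?_eq (by omega) ih]
    rfl

theorem normalForm_agen_pow_mul [NeZero n] (i : Fin n) (k : ℕ) (s : Scyc n) :
    (normalForm (agen i ^ k * s)).1 = (act i)^[k] (normalForm s).1 := by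
  induction k with
  | zero => rw [pow_zero, one_mul]; rfl
  | succ k ih => rw [pow_succ', mul_assoc, normalForm_agen_mul, ih, Function.iterate_succ_apply']

theorem isReduced_append_of_head?_of_getLast? (hn : 3 ≤ n) {i : Fin n} {u v : List (Fin n)}
    (hu : IsReduced u) (hv : IsReduced v) (hu' : u.getLast? = some (finRotate n i))
    (hv' : v.head? = some i) : IsReduced (u ++ v) := by
  refine isReduced_append (by omega) hu hv fun a ha b hb => ?_
  rw [hu', Option.mem_some_iff] at ha
  rw [hv', Option.mem_some_iff] at hb
  rw [← ha, ← hb]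
  exact (finRotate_finRotate_apply_ne hn i).symm

/-- The elements of `S_n` whose reduced word starts with `i` and ends with `i + 1`. -/
def cornerSubsemigroup [NeZero n] (hn : 3 ≤ n) (i : Fin n) : Subsemigroup (Scyc n) where
  carrier := {s | (normalForm s).1.2.head? = some i ∧
    (normalForm s).1.2.getLast? = some (finRotate n i)}
  mul_mem' {s t} hs ht := by
    have h := normalForm_mul_of_isReduced s t <| isReduced_append_of_head?_of_getLast? hn
      (normalForm s).2 (normalForm t).2 hs.2 ht.1
    refine ⟨?_, ?_⟩
    · rw [h, List.head?_append, hs.1]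
      rfl
    · rw [h, List.getLast?_append, ht.2]
      rfl

theorem mem_cornerSubsemigroup [NeZero n] {hn : 3 ≤ n} {i : Fin n} {s : Scyc n} :
    s ∈ cornerSubsemigroup hn i ↔ (normalForm s).1.2.head? = some i ∧
      (normalForm s).1.2.getLast? = some (finRotate n i) := Iff.rfl

theorem one_notMem_cornerSubsemigroup [NeZero n] (hn : 3 ≤ n) (i : Fin n) :
    1 ∉ cornerSubsemigroup hn i := by
  simp [mem_cornerSubsemigroup, normalForm_one]

theorem exists_mul_mul_mem_cornerSubsemigroup [NeZero n] (hn : 3 ≤ n) (i : Fin n)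
    (A : Finset (Scyc n)) : ∃ p q, ∀ s ∈ A, p * s * q ∈ cornerSubsemigroup hn i := by
  obtain ⟨l, hl⟩ := ((eventually_all_finset A).2 fun s _ =>
    eventually_replicate_suffix (by omega) (finRotate n i) s 1).exists
  have hlast (s) (hs : s ∈ A) : (normalForm (s * agen (finRotate n i) ^ l)).1.2.getLast? =
      some (finRotate n i) := by
    obtain ⟨t, ht⟩ := hl s hs
    rw [← ht]
    simp [-finRotate_apply]
  obtain ⟨k, hk⟩ := ((eventually_all_finset A).2 fun s hs =>
    eventually_head?_act hn (hlast s hs)).exists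
  refine ⟨agen i ^ k, agen (finRotate n i) ^ l, fun s hs => ?_⟩
  rw [mul_assoc, mem_cornerSubsemigroup, normalForm_agen_pow_mul]
  exact hk s hs

theorem normalForm_mul_of_mem [NeZero n] {hn : 3 ≤ n} {i : Fin n} {s t : Scyc n}
    (hs : s = 1 ∨ s ∈ cornerSubsemigroup hn i) (ht : t ∈ cornerSubsemigroup hn i) :
    (normalForm (s * t)).1 = ((normalForm s).1.1 + (normalForm t).1.1,
      (normalForm s).1.2 ++ (normalForm t).1.2) := by
  rcases hs with rfl | hs
  · simp [normalForm_one]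
  · exact normalForm_mul_of_isReduced s t <| isReduced_append_of_head?_of_getLast? hn
      (normalForm s).2 (normalForm t).2 hs.2 ht.1

/-- The size of a normal form `z ^ m * w`: first the exponent `m`, then the length of `w`. -/
noncomputable def size [NeZero n] (s : Scyc n) : ℕ ×ₗ ℕ :=
  toLex ((normalForm s).1.1, (normalForm s).1.2.length)

theorem exists_uniqueMul_of_cornerSubsemigroup [NeZero n] {hn : 3 ≤ n} {i : Fin n}
    {A B : Finset (Scyc n)} (hA : A.Nonempty) (hB : B.Nonempty)
    (hA' : ∀ s ∈ A, s = 1 ∨ s ∈ cornerSubsemigroup hn i)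
    (hB' : ∀ t ∈ B, t ∈ cornerSubsemigroup hn i) :
    ∃ a ∈ A, ∃ b ∈ B, UniqueMul A B a b ∧ a * b ∉ A ∧ a * b ≠ 1 := by
  have hsize (s) (hs : s ∈ A) (t) (ht : t ∈ B) : size (s * t) = size s + size t := by
    rw [size, normalForm_mul_of_mem (hA' s hs) (hB' t ht), List.length_append]
    rfl
  obtain ⟨a, ha, hamax⟩ := A.exists_max_image size hA
  obtain ⟨b, hb, hbmax⟩ := B.exists_max_image size hB
  have hb0 : 0 < (normalForm b).1.2.length := by
    rw [List.length_pos_iff]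
    intro h
    have := (hB' b hb).1
    simp [h] at this
  have hlt : size a < size (a * b) := by
    rw [hsize a ha b hb]
    refine lt_add_of_pos_right _ (Prod.Lex.lt_iff.2 ?_)
    rcases Nat.eq_zero_or_pos (normalForm b).1.1 with h | h
    · exact Or.inr ⟨h.symm, hb0⟩
    · exact Or.inl h
  refine ⟨a, ha, b, hb, ?_, fun h => (hamax _ h).not_gt hlt, fun h => ?_⟩
  · intro s t hs ht hst
    have h1 := hsize s hs t ht
    rw [hst, hsize a ha b hb] at h1
    have hsa : size s = size a := by
      refine (hamax s hs).antisymm (le_of_not_gt fun hlt => ?_)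
      exact (add_lt_add_of_lt_of_le hlt (hbmax t ht)).ne h1.symm
    have h2 := normalForm_mul_of_mem (hA' s hs) (hB' t ht)
    rw [hst, normalForm_mul_of_mem (hA' a ha) (hB' b hb)] at h2
    have hlen : (normalForm s).1.2.length = (normalForm a).1.2.length :=
      congrArg (fun p => (ofLex p).2) hsa
    have hw := (List.append_inj (congrArg Prod.snd h2) hlen.symm).1
    have has : s = a :=
      normalForm_injective (Subtype.ext (Prod.ext (congrArg (fun p => (ofLex p).1) hsa) hw.symm))
    subst has
    exact ⟨rfl, mul_left_cancel hst⟩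
  · have h1 := normalForm_mul_of_mem (hA' a ha) (hB' b hb)
    rw [h, normalForm_one] at h1
    have h2 := congrArg (fun p => p.2.length) h1
    simp only [List.length_nil, List.length_append] at h2
    omega

end Scyc

/-- the monoid algebra `K[S_n]` is semiprimitive, i.e. its Jacobson radical
(the Jacobson radical of the zero ideal) is zero. -/
theorem semiprimitive (K : Type*) [Field K] (n : ℕ) (hn : 3 ≤ n) :
    Ideal.jacobson (⊥ : Ideal (MonoidAlgebra K (Scyc n))) = ⊥ := by
  have : NeZero n := ⟨by omega⟩
  exact MonoidAlgebra.jacobson_bot_eq_bot_of_subsemigroup (Scyc.deg n) Scyc.eq_one_of_deg_eq_one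
    (Scyc.cornerSubsemigroup hn 0) (Scyc.one_notMem_cornerSubsemigroup hn 0)
    (Scyc.exists_mul_mul_mem_cornerSubsemigroup hn 0)
    fun _ _ hA hB hA' hB' => Scyc.exists_uniqueMul_of_cornerSubsemigroup hA hB hA' hB'
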